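/- arXiv:1011.2738 — 6 statements merged into one kernel-verified Lean document; each statement's English description precedes it below -/
import Mathlib

section
/- There exist an absolute constant c > 0 and an absolute constant p₀ such that for every prime p ≥ p₀ and every set A ⊆ F_p \ {0} with 2 ≤ |A| and |A|² < p, one has max(|A:A|, |A−A|) ≥ c · |A|^{1+1/11}. -/
open Pointwise

section AddCommGroup

variable {G : Type*} [AddCommGroup G] [DecidableEq G]

theorem card_add_add_le_of_forall_subset {X B : Finset G} {κ : ℝ}
    (h : ∀ Z ⊆ X, ((X + B).card : ℝ) - (Z + B).card ≤ κ * (X.card - Z.card)) (hκ : 0 ≤ κ)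
    (C : Finset G) : ((X + B + C).card : ℝ) ≤ κ * (X + C).card := by
  induction C using Finset.induction_on with
  | empty => simp
  | insert c C _ ih =>
    classical
    set Z := X.filter fun x => ∀ b ∈ B, x + b + c ∈ X + B + C with hZ
    have hZX : Z ⊆ X := Finset.filter_subset _ _
    have h1 : X + B + insert c C ⊆ (X + B + C) ∪ ((X + B) \ (Z + B) + {c}) := by
      intro u hu
      obtain ⟨v, hv, w, hw, rfl⟩ := Finset.mem_add.1 hu
      rcases Finset.mem_insert.1 hw with rfl | hw
      · by_cases hvZ : v ∈ Z + B
        · obtain ⟨z, hz, b, hb, rfl⟩ := Finset.mem_add.1 hvZ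
          exact Finset.mem_union_left _ ((Finset.mem_filter.1 hz).2 b hb)
        · exact Finset.mem_union_right _
            (Finset.add_mem_add (Finset.mem_sdiff.2 ⟨hv, hvZ⟩) (Finset.mem_singleton_self _))
      · exact Finset.mem_union_left _ (Finset.add_mem_add hv hw)
    have h2 : (X + C) ∪ ((X \ Z) + {c}) ⊆ X + insert c C := by
      apply Finset.union_subset
      · exact Finset.add_subset_add_left (Finset.subset_insert _ _)
      · exact Finset.add_subset_add Finset.sdiff_subset (by simp)
    have h3 : Disjoint (X + C) ((X \ Z) + {c}) := by
      rw [Finset.disjoint_left]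
      intro u hu hu'
      obtain ⟨x, hx, w, hw, rfl⟩ := Finset.mem_add.1 hu'
      rw [Finset.mem_singleton] at hw
      subst hw
      obtain ⟨x', hx', c', hc', he⟩ := Finset.mem_add.1 hu
      obtain ⟨hx, hxZ⟩ := Finset.mem_sdiff.1 hx
      refine hxZ (Finset.mem_filter.2 ⟨hx, fun b hb => ?_⟩)
      have : x + b + w = x' + b + c' := by
        rw [add_right_comm, ← he, add_right_comm]
      rw [this]
      exact Finset.add_mem_add (Finset.add_mem_add hx' hb) hc'
    have c1 := (Finset.card_le_card h1).trans (Finset.card_union_le _ _)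
    have c2 := Finset.card_le_card h2
    rw [Finset.card_union_of_disjoint h3] at c2
    rw [Finset.card_add_singleton] at c1 c2
    have s1 := Finset.card_sdiff_add_card_eq_card
      (Finset.add_subset_add_right (t := B) hZX)
    have s2 := Finset.card_sdiff_add_card_eq_card hZX
    have hh := h Z hZX
    rify at c1 c2 s1 s2
    nlinarith

/-- A form of Petridis's lemma: a set with small sumset `A + B` has a large subset `X` such that
adding `B` to any `X + C` enlarges it by a bounded factor. -/
theorem exists_subset_card_add_add_le {A B : Finset G} {K : ℝ} (hK : 0 < K)
    (hAB : ((A + B).card : ℝ) ≤ K * A.card) :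
    ∃ X ⊆ A, (A.card : ℝ) ≤ 2 * X.card ∧
      ∀ C : Finset G, ((X + B + C).card : ℝ) ≤ 2 * K * (X + C).card := by
  obtain ⟨X, hX, hmax⟩ := Finset.exists_max_image A.powerset
    (fun X => 2 * K * (X.card : ℝ) - (X + B).card) ⟨A, by simp⟩
  rw [Finset.mem_powerset] at hX
  have h0 := hmax A (by simp)
  refine ⟨X, hX, ?_, fun C => card_add_add_le_of_forall_subset (fun Z hZ => ?_) (by positivity) C⟩
  · have : K * (A.card : ℝ) ≤ K * (2 * X.card) := by
      have := Nat.cast_nonneg (α := ℝ) (X + B).card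
      linarith
    exact le_of_mul_le_mul_left this hK
  · have := hmax Z (Finset.mem_powerset.2 (hZ.trans hX))
    linarith

end AddCommGroup

section Field

variable {F : Type*} [Field F] [DecidableEq F]

theorem card_filter_mul_mem_smul {A : Finset F} {a x : F} (ha : a ≠ 0) :
    (A.filter fun y => a * y ∈ x • A).card = (a • A ∩ x • A).card := by
  rw [← Finset.card_image_of_injective _ (mul_right_injective₀ ha)]
  congr 1
  ext u
  simp only [Finset.mem_image, Finset.mem_filter, Finset.mem_inter, Finset.mem_smul_finset,
    smul_eq_mul]
  constructor
  · rintro ⟨y, ⟨hy, h⟩, rfl⟩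
    exact ⟨⟨y, hy, rfl⟩, h⟩
  · rintro ⟨⟨y, hy, rfl⟩, h⟩
    exact ⟨y, ⟨hy, h⟩, rfl⟩

theorem card_filter_div_eq {A : Finset F} (hA : ∀ a ∈ A, a ≠ 0) {a x : F} (ha : a ≠ 0) :
    ((A ×ˢ A).filter fun q => q.1 / q.2 = x / a).card = (a • A ∩ x • A).card := by
  refine Finset.card_bij (fun q _ => a * q.1) ?_ ?_ ?_
  · rintro ⟨u, v⟩ h
    simp only [Finset.mem_filter, Finset.mem_product] at h
    obtain ⟨⟨hu, hv⟩, h⟩ := h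
    rw [div_eq_div_iff (hA v hv) ha] at h
    refine Finset.mem_inter.2 ⟨Finset.mem_smul_finset.2 ⟨u, hu, rfl⟩,
      Finset.mem_smul_finset.2 ⟨v, hv, ?_⟩⟩
    simp only [smul_eq_mul]
    rw [← h, mul_comm]
  · rintro ⟨u, v⟩ h ⟨u', v'⟩ h' e
    simp only [Finset.mem_filter, Finset.mem_product] at h h' e
    obtain ⟨⟨hu, hv⟩, h⟩ := h
    obtain ⟨⟨hu', hv'⟩, h'⟩ := h'
    have e := mul_left_cancel₀ ha e
    subst e
    rw [← h', div_eq_div_iff (hA v hv) (hA v' hv')] at h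
    have := mul_left_cancel₀ (hA u hu) h
    rw [this]
  · intro w hw
    simp only [Finset.mem_inter, Finset.mem_smul_finset, smul_eq_mul] at hw
    obtain ⟨⟨u, hu, rfl⟩, v, hv, h⟩ := hw
    refine ⟨(u, v), Finset.mem_filter.2 ⟨Finset.mem_product.2 ⟨hu, hv⟩, ?_⟩, rfl⟩
    rw [div_eq_div_iff (hA v hv) ha, mul_comm u a, h]

theorem card_filter_inter_smul_lt_le {A : Finset F} (hA : ∀ a ∈ A, a ≠ 0) {t : ℝ}
    (ht : 0 ≤ t) :
    (((A ×ˢ A).filter fun q => ((q.2 • A ∩ q.1 • A).card : ℝ) < t).card : ℝ) ≤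
      (A / A).card * t := by
  rw [Finset.card_eq_sum_card_fiberwise (f := fun q : F × F => q.1 / q.2) (t := A / A)]
  · push_cast
    rw [← nsmul_eq_mul]
    apply Finset.sum_le_card_nsmul
    intro l _
    by_cases hne : (((A ×ˢ A).filter fun q => ((q.2 • A ∩ q.1 • A).card : ℝ) < t).filter
        fun q => q.1 / q.2 = l).Nonempty
    · obtain ⟨⟨x, a⟩, hq⟩ := hne
      simp only [Finset.mem_filter, Finset.mem_product] at hq
      obtain ⟨⟨⟨hx, ha⟩, hlt⟩, rfl⟩ := hq
      rw [← card_filter_div_eq hA (hA a ha)] at hlt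
      refine le_trans ?_ hlt.le
      exact_mod_cast Finset.card_le_card
        (Finset.filter_subset_filter _ (Finset.filter_subset _ _))
    · rw [Finset.not_nonempty_iff_eq_empty.1 hne]
      simpa using ht
  · intro q hq
    have hq := (Finset.mem_filter.1 hq).1
    exact Finset.div_mem_div (Finset.mem_product.1 hq).1 (Finset.mem_product.1 hq).2

/-- If `A / A` is small, some dilate `x • A` has a large intersection with `z • A` for many
`z ∈ A`, and those `z` are themselves plentiful in the sets `a⁻¹ • x • A`. -/
theorem exists_dense_center {A : Finset F} (hA : ∀ a ∈ A, a ≠ 0) (hne : A.Nonempty) {L : ℝ}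
    (hL : 0 < L) (hdiv : ((A / A).card : ℝ) ≤ L * A.card) :
    ∃ x ∈ A, ∃ B₁ B₂ : Finset F, B₁ ⊆ B₂ ∧ B₂ ⊆ A ∧ (A.card : ℝ) ≤ 4 * B₁.card ∧
      (∀ z ∈ B₂, (A.card : ℝ) ≤ 16 * L * (z • A ∩ x • A).card) ∧
      ∀ a ∈ B₁, (A.card : ℝ) ≤ 4 * L * (B₂.filter fun y => a * y ∈ x • A).card := by
  set n : ℝ := (A.card : ℝ) with hn
  have hn0 : 0 < n := by rw [hn]; exact_mod_cast hne.card_pos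
  set m : F × F → ℝ := fun q => (q.2 • A ∩ q.1 • A).card with hm
  set bad : F × F → Finset F :=
    fun q => A.filter fun y => q.2 * y ∈ q.1 • A ∧ m (q.1, y) < n / (16 * L) with hbad
  set P := (A ×ˢ A).filter fun q => ¬ m q < n / (2 * L) with hP
  have hPcard : n ^ 2 / 2 ≤ (P.card : ℝ) := by
    have h1 := card_filter_inter_smul_lt_le hA (t := n / (2 * L)) (by positivity)
    have h2 := Finset.card_filter_add_card_filter_not (s := A ×ˢ A)
      (fun q => m q < n / (2 * L))
    rw [Finset.card_product] at h2
    rify at h2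
    have h3 : ((A / A).card : ℝ) * (n / (2 * L)) ≤ n ^ 2 / 2 := by
      calc ((A / A).card : ℝ) * (n / (2 * L)) ≤ (L * n) * (n / (2 * L)) := by gcongr
        _ = n ^ 2 / 2 := by field_simp
    linarith
  have hbadsum : ∑ q ∈ A ×ˢ A, ((bad q).card : ℝ) ≤ n ^ 2 * (n / (16 * L)) := by
    have h1 : ∑ q ∈ A ×ˢ A, ((bad q).card : ℝ) =
        ∑ q ∈ A ×ˢ A, if m q < n / (16 * L) then m q else 0 := by
      rw [Finset.sum_product, Finset.sum_product]
      refine Finset.sum_congr rfl fun u hu => ?_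
      simp only [hbad, Finset.card_filter]
      push_cast
      rw [Finset.sum_comm]
      refine Finset.sum_congr rfl fun y hy => ?_
      split_ifs with h
      · have hmy : m (u, y) = ∑ a ∈ A, if a * y ∈ u • A then 1 else 0 := by
          simp only [hm]
          rw [← card_filter_mul_mem_smul (hA y hy), Finset.card_filter]
          push_cast
          simp only [mul_comm]
        simp only [h, and_true]
        exact hmy.symm
      · simp [h]
    rw [h1]
    calc _ ≤ ∑ q ∈ A ×ˢ A, n / (16 * L) := by
          refine Finset.sum_le_sum fun q _ => ?_
          split_ifs with h
          · exact h.le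
          · positivity
      _ = _ := by
          rw [Finset.sum_const, Finset.card_product, nsmul_eq_mul]
          push_cast
          ring
  set G := P.filter fun q => ¬ n / (4 * L) ≤ ((bad q).card : ℝ) with hG
  have hGcard : n ^ 2 / 4 ≤ (G.card : ℝ) := by
    have h1 := Finset.card_filter_add_card_filter_not (s := P)
      (fun q => n / (4 * L) ≤ ((bad q).card : ℝ))
    have h2 : ((P.filter fun q => n / (4 * L) ≤ ((bad q).card : ℝ)).card : ℝ) * (n / (4 * L)) ≤
        ∑ q ∈ A ×ˢ A, ((bad q).card : ℝ) := by
      rw [← nsmul_eq_mul]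
      refine (Finset.card_nsmul_le_sum _ (fun q => ((bad q).card : ℝ)) _ fun q hq =>
        (Finset.mem_filter.1 hq).2).trans ?_
      exact Finset.sum_le_sum_of_subset_of_nonneg
        ((Finset.filter_subset _ _).trans (Finset.filter_subset _ _)) fun _ _ _ => by positivity
    have h3 : n ^ 2 * (n / (16 * L)) = n ^ 2 / 4 * (n / (4 * L)) := by field_simp; norm_num
    have h4 := le_of_mul_le_mul_right (h2.trans (hbadsum.trans h3.le)) (by positivity)
    rify at h1
    linarith
  obtain ⟨x, hx, hxG⟩ : ∃ x ∈ A, n / 4 ≤ ((G.filter fun q => q.1 = x).card : ℝ) := by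
    by_contra! hcon
    have h1 : (G.card : ℝ) = ∑ x ∈ A, ((G.filter fun q => q.1 = x).card : ℝ) := by
      rw [Finset.card_eq_sum_card_fiberwise (f := Prod.fst) (t := A)]
      · push_cast; rfl
      · intro q hq
        exact (Finset.mem_product.1 (Finset.mem_filter.1 (Finset.mem_filter.1 hq).1).1).1
    have h2 := Finset.sum_lt_sum_of_nonempty hne hcon
    rw [Finset.sum_const, nsmul_eq_mul] at h2
    nlinarith
  have hB : ∀ a ∈ A.filter (fun a => (x, a) ∈ G), n / (2 * L) ≤ m (x, a) ∧
      ((bad (x, a)).card : ℝ) < n / (4 * L) := by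
    intro a ha
    have h := (Finset.mem_filter.1 ha).2
    simp only [hG, hP, Finset.mem_filter, not_lt, not_le] at h
    exact ⟨h.1.2, h.2⟩
  refine ⟨x, hx, A.filter (fun a => (x, a) ∈ G), A.filter (fun z => n / (16 * L) ≤ m (x, z)),
    ?_, Finset.filter_subset _ _, ?_, ?_, ?_⟩
  · intro a ha
    refine Finset.mem_filter.2 ⟨(Finset.mem_filter.1 ha).1, le_trans ?_ (hB a ha).1⟩
    gcongr
    norm_num
  · have : (G.filter fun q => q.1 = x).card ≤ (A.filter (fun a => (x, a) ∈ G)).card := by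
      refine Finset.card_le_card_of_injOn Prod.snd ?_ ?_
      · rintro ⟨u, a⟩ hq
        simp only [Finset.coe_filter, Set.mem_ofPred_eq] at hq ⊢
        obtain ⟨hq, rfl⟩ := hq
        exact ⟨(Finset.mem_product.1 (Finset.mem_filter.1 (Finset.mem_filter.1 hq).1).1).2, hq⟩
      · rintro ⟨u, a⟩ hq ⟨u', a'⟩ hq' e
        simp only [Finset.coe_filter, Set.mem_ofPred_eq] at hq hq' e
        rw [hq.2, hq'.2, e]
    rify at this
    linarith
  · intro z hz
    have := (Finset.mem_filter.1 hz).2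
    rw [div_le_iff₀ (by positivity)] at this
    linarith
  · intro a ha
    obtain ⟨h1, h2⟩ := hB a ha
    have h3 := Finset.card_filter_add_card_filter_not (s := A.filter fun y => a * y ∈ x • A)
      (fun y => m (x, y) < n / (16 * L))
    rw [card_filter_mul_mem_smul (hA a (Finset.mem_filter.1 ha).1), Finset.filter_filter,
      Finset.filter_filter] at h3
    have h4 : (A.filter fun y => a * y ∈ x • A ∧ ¬ m (x, y) < n / (16 * L)) =
        (A.filter (fun z => n / (16 * L) ≤ m (x, z))).filter fun y => a * y ∈ x • A := by
      ext y
      simp only [Finset.mem_filter, not_lt]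
      tauto
    rw [h4] at h3
    rify at h3
    have h5 : n / (2 * L) = 2 * (n / (4 * L)) := by field_simp; norm_num
    have h6 : n / (4 * L) ≤
      (((A.filter (fun z => n / (16 * L) ≤ m (x, z))).filter fun y => a * y ∈ x • A).card : ℝ) := by
      simp only [hbad, hm] at h1 h2 h3 ⊢
      linarith
    rw [div_le_iff₀ (by positivity)] at h6
    linarith

/-- If `A - A` is small and `z • A` meets `x • A` in a large set, then `z • A` may be replaced by
`x • A` in sumsets at bounded cost. -/
theorem card_smul_add_le_of_card_le_inter {A : Finset F} {L M : ℝ} {x z : F} (hL : 0 ≤ L)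
    (hM : 0 ≤ M) (hne : A.Nonempty) (hsub : ((A - A).card : ℝ) ≤ L * A.card)
    (hT : (A.card : ℝ) ≤ M * (z • A ∩ x • A).card) (C : Finset F) :
    ((z • A + C).card : ℝ) ≤ L * M * (x • A + C).card := by
  set T := z • A ∩ x • A with hTdef
  have hA0 : (0 : ℝ) < A.card := by exact_mod_cast hne.card_pos
  have hT0 : (0 : ℝ) < T.card := by
    rcases (Nat.cast_nonneg (α := ℝ) T.card).eq_or_lt with h | h
    · rw [← h] at hT
      linarith
    · exact h
  have h1 : ((z • A + C).card : ℝ) * T.card ≤ (T - z • A).card * (T + C).card := by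
    rw [mul_comm]
    exact_mod_cast Finset.ruzsa_triangle_inequality_add_sub_add (z • A) T C
  have h2 : ((T - z • A).card : ℝ) ≤ (A - A).card := by
    have : T - z • A ⊆ z • (A - A) := by
      intro u hu
      obtain ⟨v, hv, w, hw, rfl⟩ := Finset.mem_sub.1 hu
      obtain ⟨v, hv', rfl⟩ := Finset.mem_smul_finset.1 (Finset.mem_inter.1 hv).1
      obtain ⟨w, hw', rfl⟩ := Finset.mem_smul_finset.1 hw
      rw [← smul_sub]
      exact Finset.smul_mem_smul_finset (Finset.sub_mem_sub hv' hw')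
    exact_mod_cast (Finset.card_le_card this).trans Finset.card_smul_finset_le
  have h3 : ((T + C).card : ℝ) ≤ (x • A + C).card := by
    exact_mod_cast Finset.card_le_card (Finset.add_subset_add_right Finset.inter_subset_right)
  refine le_of_mul_le_mul_right ?_ hT0
  calc ((z • A + C).card : ℝ) * T.card ≤ (T - z • A).card * (T + C).card := h1
    _ ≤ (L * (M * T.card)) * (x • A + C).card := by
      gcongr
      exact h2.trans (hsub.trans (by gcongr))
    _ = _ := by ring

theorem card_neg_smul_add_le {A : Finset F} {M : ℝ} {x z : F}
    (h : ∀ C : Finset F, ((z • A + C).card : ℝ) ≤ M * (x • A + C).card) (C : Finset F) :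
    (((-z) • A + C).card : ℝ) ≤ M * ((-x) • A + C).card := by
  have key : ∀ w : F, ((-w) • A + C).card = (w • A + -C).card := by
    intro w
    rw [← Finset.card_neg (w • A + -C), neg_add, neg_neg]
    congr 2
    exact Finset.neg_smul_finset
  rw [key, key]
  exact h _

theorem card_smul_add_smul_add_smul_le {A : Finset F} {M : ℝ} {x₁ x₂ x₃ z₁ z₂ z₃ : F} (hM : 0 ≤ M)
    (h₁ : ∀ C : Finset F, ((z₁ • A + C).card : ℝ) ≤ M * (x₁ • A + C).card)
    (h₂ : ∀ C : Finset F, ((z₂ • A + C).card : ℝ) ≤ M * (x₂ • A + C).card)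
    (h₃ : ∀ C : Finset F, ((z₃ • A + C).card : ℝ) ≤ M * (x₃ • A + C).card) (C : Finset F) :
    ((z₁ • A + z₂ • A + z₃ • A + C).card : ℝ) ≤
      M ^ 3 * (x₁ • A + x₂ • A + x₃ • A + C).card := by
  have e₁ := h₁ (z₂ • A + z₃ • A + C)
  have e₂ := h₂ (x₁ • A + z₃ • A + C)
  have e₃ := h₃ (x₁ • A + x₂ • A + C)
  have p₁ : z₁ • A + (z₂ • A + z₃ • A + C) = z₁ • A + z₂ • A + z₃ • A + C := by abel
  have p₂ : x₁ • A + (z₂ • A + z₃ • A + C) = z₂ • A + (x₁ • A + z₃ • A + C) := by abel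
  have p₃ : x₂ • A + (x₁ • A + z₃ • A + C) = z₃ • A + (x₁ • A + x₂ • A + C) := by abel
  have p₄ : x₃ • A + (x₁ • A + x₂ • A + C) = x₁ • A + x₂ • A + x₃ • A + C := by abel
  rw [p₁, p₂] at e₁
  rw [p₃] at e₂
  rw [p₄] at e₃
  calc _ ≤ _ := e₁
    _ ≤ M * (M * (M * (x₁ • A + x₂ • A + x₃ • A + C).card)) := by
      gcongr
      exact e₂.trans (by gcongr)
    _ = _ := by ring

theorem sq_card_le_card_image_mul {α β : Type*} [DecidableEq β] (S : Finset α) (f : α → β) :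
    S.card ^ 2 ≤ (S.image f).card * ((S ×ˢ S).filter fun q => f q.1 = f q.2).card := by
  have h1 : S.card = ∑ v ∈ S.image f, (S.filter fun s => f s = v).card :=
    Finset.card_eq_sum_card_image f S
  have h2 : ((S ×ˢ S).filter fun q => f q.1 = f q.2).card =
      ∑ v ∈ S.image f, (S.filter fun s => f s = v).card ^ 2 := by
    rw [Finset.card_eq_sum_card_fiberwise (f := fun q : α × α => f q.1) (t := S.image f)]
    · refine Finset.sum_congr rfl fun v _ => ?_
      rw [sq, ← Finset.card_product, ← Finset.filter_product, Finset.filter_filter]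
      congr 1
      refine Finset.filter_congr fun q _ => ?_
      constructor
      · rintro ⟨h, h'⟩
        exact ⟨h', h ▸ h'⟩
      · rintro ⟨h, h'⟩
        exact ⟨h.trans h'.symm, h⟩
    · intro q hq
      exact Finset.mem_image_of_mem _ (Finset.mem_product.1 (Finset.mem_filter.1 hq).1).1
  rw [h2]
  conv_lhs => rw [h1]
  exact sq_sum_le_card_mul_sum_sq

/-- A set of size at most the square root of the field has a dilate with which it spans a sumset of
nearly maximal size. -/
theorem exists_sq_card_le_two_mul_card_add_smul [Fintype F] {A : Finset F} (hne : A.Nonempty)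
    (hA : A.card ^ 2 ≤ Fintype.card F) : ∃ ξ : F, A.card ^ 2 ≤ 2 * (A + ξ • A).card := by
  set S := A ×ˢ A with hS
  have hScard : S.card = A.card ^ 2 := by rw [hS, Finset.card_product, sq]
  set e : F → ℕ := fun ξ =>
    ((S ×ˢ S).filter fun q => q.1.1 + ξ * q.1.2 = q.2.1 + ξ * q.2.2).card with he
  have hsum : ∑ ξ, e ξ ≤ Fintype.card F * (2 * A.card ^ 2) := by
    have h1 : ∑ ξ, e ξ = ∑ s ∈ S, ∑ t ∈ S,
        (Finset.univ.filter fun ξ : F => s.1 + ξ * s.2 = t.1 + ξ * t.2).card := by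
      rw [← Finset.sum_product' S S
        (fun s t => (Finset.univ.filter fun ξ : F => s.1 + ξ * s.2 = t.1 + ξ * t.2).card)]
      simp only [he, Finset.card_filter]
      rw [Finset.sum_comm]
    have h2 : ∀ s ∈ S, ∑ t ∈ S,
        (Finset.univ.filter fun ξ : F => s.1 + ξ * s.2 = t.1 + ξ * t.2).card ≤
        2 * Fintype.card F := by
      intro s hs
      rw [← Finset.add_sum_erase S _ hs]
      have h3 : ∀ t ∈ S.erase s,
          (Finset.univ.filter fun ξ : F => s.1 + ξ * s.2 = t.1 + ξ * t.2).card ≤ 1 := by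
        intro t ht
        rw [Finset.card_le_one]
        intro ξ hξ η hη
        simp only [Finset.mem_filter, Finset.mem_univ, true_and] at hξ hη
        by_contra hne
        have h4 : (ξ - η) * (s.2 - t.2) = 0 := by linear_combination hξ - hη
        have h5 : s.2 = t.2 :=
          sub_eq_zero.1 ((mul_eq_zero.1 h4).resolve_left (sub_ne_zero.2 hne))
        rw [h5] at hξ
        exact (Finset.mem_erase.1 ht).1 (Prod.ext (add_right_cancel hξ).symm h5.symm)
      have h6 := Finset.sum_le_card_nsmul _ _ _ h3
      have h7 : (S.erase s).card ≤ S.card := Finset.card_erase_le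
      have h8 : (Finset.univ.filter fun ξ : F => s.1 + ξ * s.2 = s.1 + ξ * s.2).card =
        Fintype.card F := by simp
      rw [h8]
      simp only [smul_eq_mul, mul_one] at h6
      omega
    rw [h1]
    refine (Finset.sum_le_card_nsmul _ _ _ h2).trans ?_
    rw [hScard, smul_eq_mul]
    exact le_of_eq (by ring)
  obtain ⟨ξ, -, hξ⟩ : ∃ ξ ∈ (Finset.univ : Finset F), e ξ ≤ 2 * A.card ^ 2 := by
    apply Finset.exists_le_of_sum_le Finset.univ_nonempty
    rw [Finset.sum_const, Finset.card_univ, smul_eq_mul]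
    exact hsum
  refine ⟨ξ, ?_⟩
  have h1 := sq_card_le_card_image_mul S (fun s => s.1 + ξ * s.2)
  have h2 : S.image (fun s => s.1 + ξ * s.2) ⊆ A + ξ • A := by
    intro u hu
    obtain ⟨s, hs, rfl⟩ := Finset.mem_image.1 hu
    obtain ⟨hs1, hs2⟩ := Finset.mem_product.1 hs
    exact Finset.add_mem_add hs1 (Finset.smul_mem_smul_finset hs2)
  have h3 := Finset.card_le_card h2
  have h4 : 0 < A.card ^ 2 := pow_pos hne.card_pos 2
  rw [hScard] at h1
  have h5 : A.card ^ 2 * A.card ^ 2 ≤ (2 * (A + ξ • A).card) * A.card ^ 2 := by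
    calc A.card ^ 2 * A.card ^ 2 = (A.card ^ 2) ^ 2 := by ring
      _ ≤ _ := h1
      _ ≤ (A + ξ • A).card * (2 * A.card ^ 2) := Nat.mul_le_mul h3 hξ
      _ = _ := by ring
  exact le_of_mul_le_mul_right h5 h4

theorem ZMod.exists_mem_sub_one_notMem {p : ℕ} [NeZero p] {R : Set (ZMod p)} (h0 : 0 ∈ R)
    (hR : R ≠ Set.univ) : ∃ r ∈ R, r - 1 ∉ R := by
  by_contra! h
  refine hR (Set.eq_univ_of_forall fun x => ?_)
  have key : ∀ k : ℕ, -(k : ZMod p) ∈ R := by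
    intro k
    induction k with
    | zero => simpa using h0
    | succ k ih =>
      have := h _ ih
      rwa [← neg_add', ← Nat.cast_succ] at this
  simpa using key (-x).val

end Field

theorem card_le_of_small_difference_ratio {p : ℕ} [Fact p.Prime] {A : Finset (ZMod p)}
    (hA : ∀ a ∈ A, a ≠ 0) (hne : A.Nonempty) (hp : A.card ^ 2 ≤ p) {L : ℝ} (hL : 1 ≤ L)
    (hsub : ((A - A).card : ℝ) ≤ L * A.card) (hdiv : ((A / A).card : ℝ) ≤ L * A.card)
    (hadd : ∀ C : Finset (ZMod p), ((A - A + C).card : ℝ) ≤ L * (A + C).card) :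
    (A.card : ℝ) ≤ 2 * 16 ^ 4 * L ^ 11 := by
  have hL0 : 0 < L := by linarith
  have hA0 : (0 : ℝ) < A.card := by exact_mod_cast hne.card_pos
  have hfour : ((A - A + A - A).card : ℝ) ≤ L ^ 3 * A.card := by
    have e₁ := hadd (A - A)
    have e₂ := hadd (-A)
    have p₁ : A - A + (A - A) = A - A + A - A := by rw [add_sub_assoc]
    have p₂ : A + (A - A) = -(A - A + -A) := by
      rw [neg_add, neg_neg, neg_sub, add_comm]
    have p₃ : A + -A = A - A := (sub_eq_add_neg A A).symm
    rw [p₁, p₂, Finset.card_neg] at e₁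
    rw [p₃] at e₂
    calc _ ≤ _ := e₁
      _ ≤ L * (L * (L * A.card)) := by
        gcongr
        exact e₂.trans (by gcongr)
      _ = _ := by ring
  obtain ⟨x, hx, B₁, B₂, hB, hBA, hB₁, hB₂, hY⟩ := exists_dense_center hA hne hL0 hdiv
  set M : ℝ := L * (16 * L) with hM
  have hM0 : 0 ≤ M := by positivity
  have hrep : ∀ z ∈ B₂, ∀ C : Finset (ZMod p),
      ((z • A + C).card : ℝ) ≤ M * (x • A + C).card := fun z hz C =>
    card_smul_add_le_of_card_le_inter hL0.le (by positivity) hne hsub (hB₂ z hz) C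
  have hrep' : ∀ z ∈ B₂, ∀ C : Finset (ZMod p),
      (((-z) • A + C).card : ℝ) ≤ M * ((-x) • A + C).card := fun z hz =>
    card_neg_smul_add_le (hrep z hz)
  have hfourx : ((x • A + (-x) • A + (-x) • A + x • A).card : ℝ) ≤ L ^ 3 * A.card := by
    refine le_trans ?_ hfour
    have : x • A + (-x) • A + (-x) • A + x • A ⊆ x • (A - A + A - A) := by
      intro u hu
      simp only [Finset.mem_add, Finset.mem_smul_finset] at hu
      obtain ⟨_, ⟨_, ⟨_, ⟨a, ha, rfl⟩, _, ⟨b, hb, rfl⟩, rfl⟩, _, ⟨c, hc, rfl⟩, rfl⟩, _,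
        ⟨d, hd, rfl⟩, rfl⟩ := hu
      refine Finset.mem_smul_finset.2 ⟨a - b + d - c, Finset.sub_mem_sub
        (Finset.add_mem_add (Finset.sub_mem_sub ha hb) hd) hc, ?_⟩
      simp only [smul_eq_mul]
      ring
    exact_mod_cast (Finset.card_le_card this).trans Finset.card_smul_finset_le
  have hthree : ∀ b ∈ B₂, ∀ c ∈ B₂, ∀ d ∈ B₂,
      ((c • A + (-d) • A + (-b) • A + x • A).card : ℝ) ≤ M ^ 3 * (L ^ 3 * A.card) :=
    fun b hb c hc d hd =>
      (card_smul_add_smul_add_smul_le hM0 (hrep c hc) (hrep' d hd) (hrep' b hb) _).trans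
        (by gcongr)
  have hcard_smul : ∀ z : ZMod p, z ≠ 0 → ∀ C : Finset (ZMod p), (z • C).card = C.card :=
    fun z hz C => Finset.card_image_of_injective _ (mul_right_injective₀ hz)
  set R : Set (ZMod p) :=
    {r | ∃ a ∈ B₁, ∃ b ∈ B₁, ∃ c ∈ B₂, ∃ d ∈ B₂, c ≠ d ∧ r * (c - d) = a - b} with hR
  by_cases hRuniv : R = Set.univ
  · obtain ⟨ξ, hξ⟩ := exists_sq_card_le_two_mul_card_add_smul hne (by rwa [ZMod.card])
    have hξR : ξ ∈ R := hRuniv ▸ Set.mem_univ ξ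
    obtain ⟨a, ha, b, hb, c, hc, d, hd, hcd, he⟩ := hξR
    have hsubset : (c - d) • (A + ξ • A) ⊆ c • A + (-d) • A + (-b) • A + a • A := by
      intro u hu
      simp only [Finset.mem_add, Finset.mem_smul_finset] at hu
      obtain ⟨_, ⟨v, hv, _, ⟨w, hw, rfl⟩, rfl⟩, rfl⟩ := hu
      have : (c - d) • (v + ξ • w) = c • v + (-d) • v + (-b) • w + a • w := by
        simp only [smul_eq_mul]
        linear_combination w * he
      rw [this]
      exact Finset.add_mem_add (Finset.add_mem_add (Finset.add_mem_add
        (Finset.smul_mem_smul_finset hv) (Finset.smul_mem_smul_finset hv))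
        (Finset.smul_mem_smul_finset hw)) (Finset.smul_mem_smul_finset hw)
    have h1 := Finset.card_le_card hsubset
    rw [hcard_smul _ (sub_ne_zero.2 hcd)] at h1
    have h2 := hrep a (hB ha) (c • A + (-d) • A + (-b) • A)
    rw [add_comm, add_comm (x • A)] at h2
    have h3 := hthree b (hB hb) c hc d hd
    have h4 : (A.card : ℝ) ^ 2 ≤ 2 * (A + ξ • A).card := by exact_mod_cast hξ
    rify at h1
    have h5 : (A.card : ℝ) * A.card ≤ (2 * 16 ^ 4 * L ^ 11) * A.card := by
      calc (A.card : ℝ) * A.card = (A.card : ℝ) ^ 2 := by ring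
        _ ≤ 2 * (M * (M ^ 3 * (L ^ 3 * A.card))) := by
          refine h4.trans ?_
          gcongr
          exact h1.trans (h2.trans (by gcongr))
        _ = _ := by rw [hM]; ring
    exact le_of_mul_le_mul_right h5 hA0
  · by_cases hsmall : B₂.card ≤ 1
    · have h1 := Finset.card_le_card hB
      have h2 : (B₁.card : ℝ) ≤ 1 := by exact_mod_cast h1.trans hsmall
      have h3 : 1 ≤ L ^ 11 := one_le_pow₀ hL
      linarith
    · obtain ⟨c, hc, d, hd, hcd⟩ := Finset.one_lt_card.1 (not_le.1 hsmall)
      have hB₁ne : B₁.Nonempty := by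
        rw [← Finset.card_pos]
        have : (0 : ℝ) < B₁.card := by linarith
        exact_mod_cast this
      obtain ⟨a, ha⟩ := hB₁ne
      have h0 : (0 : ZMod p) ∈ R := ⟨a, ha, a, ha, c, hc, d, hd, hcd, by ring⟩
      clear! a c d
      obtain ⟨r, hr, hr'⟩ := ZMod.exists_mem_sub_one_notMem h0 hRuniv
      obtain ⟨a, ha, b, hb, c, hc, d, hd, hcd, he⟩ := hr
      set Y := B₂.filter fun y => a * y ∈ x • A with hYdef
      have hYA : Y ⊆ A := (Finset.filter_subset _ _).trans hBA
      have h1 : B₁.card * Y.card ≤ (A - A + r • Y).card := by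
        rw [← Finset.card_product]
        refine Finset.card_le_card_of_injOn (fun q => q.1 + (r - 1) * q.2) ?_ ?_
        · rintro ⟨v, y⟩ hq
          obtain ⟨hv, hy⟩ := Finset.mem_product.1 hq
          have : v + (r - 1) * y = v - y + r • y := by
            simp only [smul_eq_mul]
            ring
          simp only [this]
          exact Finset.add_mem_add (Finset.sub_mem_sub (hBA (hB hv)) (hYA hy))
            (Finset.smul_mem_smul_finset hy)
        · rintro ⟨v, y⟩ hq ⟨v', y'⟩ hq' heq
          obtain ⟨hv, hy⟩ := Finset.mem_product.1 hq
          obtain ⟨hv', hy'⟩ := Finset.mem_product.1 hq'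
          simp only at heq hv hy hv' hy'
          have hyy : y = y' := by
            by_contra hyy
            exact hr' ⟨v', hv', v, hv, y, (Finset.mem_filter.1 hy).1, y',
              (Finset.mem_filter.1 hy').1, hyy, by linear_combination heq⟩
          subst hyy
          rw [add_right_cancel heq]
      have h2 := hadd (r • Y)
      have hsubset : (c - d) • (A + r • Y) ⊆ c • A + (-d) • A + (-b) • A + x • A := by
        intro u hu
        simp only [Finset.mem_add, Finset.mem_smul_finset] at hu
        obtain ⟨_, ⟨v, hv, _, ⟨w, hw, rfl⟩, rfl⟩, rfl⟩ := hu
        have : (c - d) • (v + r • w) = c • v + (-d) • v + (-b) • w + a * w := by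
          simp only [smul_eq_mul]
          linear_combination w * he
        rw [this]
        exact Finset.add_mem_add (Finset.add_mem_add (Finset.add_mem_add
          (Finset.smul_mem_smul_finset hv) (Finset.smul_mem_smul_finset hv))
          (Finset.smul_mem_smul_finset (hYA hw))) (Finset.mem_filter.1 hw).2
      have h3 := Finset.card_le_card hsubset
      rw [hcard_smul _ (sub_ne_zero.2 hcd)] at h3
      have h4 := hthree b (hB hb) c hc d hd
      have h5 := hY a ha
      rify at h1 h3
      have h6 : (A.card : ℝ) * A.card ≤ (16 ^ 4 * L ^ 11) * A.card := by
        calc (A.card : ℝ) * A.card ≤ (4 * B₁.card) * (4 * L * Y.card) := by gcongr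
          _ = 16 * L * (B₁.card * Y.card) := by ring
          _ ≤ 16 * L * (L * (M ^ 3 * (L ^ 3 * A.card))) := by
            refine mul_le_mul_of_nonneg_left ?_ (by positivity)
            refine h1.trans (h2.trans ?_)
            gcongr
            exact h3.trans h4
          _ = _ := by rw [hM]; ring
      have h7 := le_of_mul_le_mul_right h6 hA0
      have h8 : 0 ≤ 16 ^ 4 * L ^ 11 := by positivity
      linarith

theorem sum_product_Fp_ratio_diff :
    ∃ c : ℝ, c > 0 ∧ ∃ p₀ : ℕ, ∀ p : ℕ, p.Prime → p₀ ≤ p →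
      ∀ (_ : Fact p.Prime) (A : Finset (ZMod p)),
        (∀ a ∈ A, a ≠ 0) → 2 ≤ A.card → A.card ^ 2 < p →
        c * (A.card : ℝ) ^ (1 + 1 / 11 : ℝ) ≤
          max ((A / A).card : ℝ) ((A - A).card : ℝ) := by
  refine ⟨1 / 8, by norm_num, 0, fun p _ _ _ A hA h2 hp => ?_⟩
  set N : ℝ := max ((A / A).card : ℝ) ((A - A).card : ℝ) with hN
  have hne : A.Nonempty := Finset.card_pos.1 (by omega)
  have hA0 : (0 : ℝ) < A.card := by exact_mod_cast hne.card_pos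
  have hAN : (A.card : ℝ) ≤ N := by
    refine le_trans ?_ (le_max_right _ _)
    exact_mod_cast Finset.card_le_card_sub_right hne
  obtain ⟨K, hK⟩ : ∃ K : ℝ, N = K * A.card := ⟨N / A.card, by field_simp⟩
  have hK1 : 1 ≤ K := by
    rw [hK] at hAN
    exact le_of_mul_le_mul_right (by linarith) hA0
  have hdiv : ((A / A).card : ℝ) ≤ K * A.card := hK ▸ le_max_left _ _
  have hsub : ((A - A).card : ℝ) ≤ K * A.card := hK ▸ le_max_right _ _
  obtain ⟨X, hXA, hX, hadd⟩ := exists_subset_card_add_add_le (A := A) (B := -A)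
    (K := K) (by linarith) (by rwa [← sub_eq_add_neg])
  have hXne : X.Nonempty := by
    rw [← Finset.card_pos]
    have : (0 : ℝ) < X.card := by linarith
    exact_mod_cast this
  have hKX : K * A.card ≤ 2 * K * X.card := by nlinarith
  have hXX : (X.card : ℝ) ≤ 2 * 16 ^ 4 * (2 * K) ^ 11 := by
    refine card_le_of_small_difference_ratio (fun a ha => hA a (hXA ha)) hXne
      (le_trans (Nat.pow_le_pow_left (Finset.card_le_card hXA) 2) hp.le) (by linarith)
      ?_ ?_ fun C => ?_
    · refine le_trans ?_ (hsub.trans hKX)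
      exact_mod_cast Finset.card_le_card (Finset.sub_subset_sub hXA hXA)
    · refine le_trans ?_ (hdiv.trans hKX)
      exact_mod_cast Finset.card_le_card (Finset.div_subset_div hXA hXA)
    · refine le_trans ?_ (hadd C)
      rw [sub_eq_add_neg]
      exact_mod_cast Finset.card_le_card
        (Finset.add_subset_add_right (Finset.add_subset_add_left (Finset.neg_subset_neg hXA)))
  have hAK : (A.card : ℝ) ≤ (8 * K) ^ 11 := by
    have h1 : 0 ≤ K ^ 11 := by positivity
    rw [mul_pow] at hXX ⊢
    norm_num at hXX ⊢
    linarith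
  have hroot : (A.card : ℝ) ^ (1 / 11 : ℝ) ≤ 8 * K := by
    calc (A.card : ℝ) ^ (1 / 11 : ℝ) ≤ ((8 * K) ^ 11) ^ (1 / 11 : ℝ) := by gcongr
      _ = 8 * K := by
        rw [one_div]
        exact_mod_cast Real.pow_rpow_inv_natCast (n := 11) (by linarith) (by norm_num)
  rw [Real.rpow_add hA0, Real.rpow_one, hK]
  nlinarith
end

section
/- (Covering lemma.) For every ε with 0 < ε < 1 there exists a constant C(ε) > 0 with the following property: for every abelian group G and all finite nonempty subsets X₁, X₂ of G, there exists a finite set T ⊆ G of translates with |T| ≤ C(ε) · min(|X₁+X₂|, |X₁−X₂|) / |X₂| such that |X₁ ∩ (T + X₂)| ≥ (1−ε)·|X₁|, i.e. the union of the translates t + X₂ over t ∈ T contains at least (1−ε)|X₁| elements of X₁. -/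
open Pointwise Finset

lemma card_mul_card_le_card_sub_mul {G : Type*} [AddCommGroup G] [DecidableEq G]
    (Y X : Finset G) (r : ℕ) (hr : ∀ t ∈ Y - X, #(Y ∩ (t +ᵥ X)) ≤ r) :
    #Y * #X ≤ #(Y - X) * r := by
  rw [← card_product, mul_comm]
  refine card_le_mul_card_image_of_maps_to (f := fun p : G × G => p.1 - p.2) ?_ r ?_
  · intro p hp
    rw [mem_product] at hp
    exact sub_mem_sub hp.1 hp.2
  · intro t ht
    refine (card_le_card_of_injOn (fun p : G × G => p.1) ?_ ?_).trans (hr t ht)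
    · rintro ⟨y, x⟩ hp
      simp only [coe_filter, mem_product, Set.mem_ofPred_eq] at hp
      simp only [mem_coe, mem_inter]
      refine ⟨hp.1.1, mem_vadd_finset.2 ⟨x, hp.1.2, ?_⟩⟩
      rw [← hp.2, vadd_eq_add, sub_add_cancel]
    · rintro ⟨y, x⟩ hp ⟨y', x'⟩ hp' h
      simp only [coe_filter, mem_product, Set.mem_ofPred_eq] at hp hp' h
      subst h
      rw [Prod.mk.injEq]
      exact ⟨rfl, sub_right_injective (hp.2.trans hp'.2.symm)⟩

lemma addEnergy_le_mul_card_mul_card {G : Type*} [AddCommGroup G] [DecidableEq G]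
    (Y X : Finset G) (r : ℕ) (hr : ∀ t ∈ Y - X, #(Y ∩ (t +ᵥ X)) ≤ r) :
    addEnergy Y X ≤ r * (#Y * #X) := by
  rw [← card_product, addEnergy]
  refine card_le_mul_card_image_of_maps_to
    (f := fun p : (G × G) × (G × G) => (p.1.1, p.2.2)) ?_ r ?_
  · intro p hp
    simp only [mem_filter, mem_product] at hp ⊢
    exact ⟨hp.1.1.1, hp.1.2.2⟩
  · rintro ⟨y, x⟩ hyx
    rw [mem_product] at hyx
    refine (card_le_card_of_injOn (fun p : (G × G) × (G × G) => p.1.2) ?_ ?_).trans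
      (hr (y - x) (sub_mem_sub hyx.1 hyx.2))
    · rintro ⟨⟨y₁, y₂⟩, x₁, x₂⟩ hp
      simp only [coe_filter, mem_filter, mem_product, Set.mem_ofPred_eq, Prod.mk.injEq] at hp
      obtain ⟨⟨⟨⟨-, hy₂⟩, hx₁, -⟩, h⟩, rfl, rfl⟩ := hp
      simp only [mem_coe, mem_inter]
      refine ⟨hy₂, mem_vadd_finset.2 ⟨x₁, hx₁, ?_⟩⟩
      rw [vadd_eq_add, sub_add_eq_add_sub, h, add_sub_cancel_right]
    · rintro ⟨⟨y₁, y₂⟩, x₁, x₂⟩ hp ⟨⟨y₁', y₂'⟩, x₁', x₂'⟩ hp' h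
      simp only [coe_filter, mem_filter, mem_product, Set.mem_ofPred_eq, Prod.mk.injEq]
        at hp hp' h
      obtain ⟨⟨-, h₁⟩, rfl, rfl⟩ := hp
      obtain ⟨⟨-, h₂⟩, rfl, rfl⟩ := hp'
      subst h
      rw [add_left_cancel (h₁.trans h₂.symm)]

lemma card_mul_card_le_card_add_mul {G : Type*} [AddCommGroup G] [DecidableEq G]
    (Y X : Finset G) (r : ℕ) (hr : ∀ t ∈ Y - X, #(Y ∩ (t +ᵥ X)) ≤ r) :
    #Y * #X ≤ #(Y + X) * r := by
  rcases Nat.eq_zero_or_pos (#Y * #X) with h0 | hpos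
  · simp [h0]
  refine Nat.le_of_mul_le_mul_right ?_ hpos
  calc #Y * #X * (#Y * #X) = #Y ^ 2 * #X ^ 2 := by ring
    _ ≤ #(Y + X) * addEnergy Y X := le_card_add_mul_addEnergy Y X
    _ ≤ #(Y + X) * (r * (#Y * #X)) :=
        Nat.mul_le_mul_left _ (addEnergy_le_mul_card_mul_card Y X r hr)
    _ = #(Y + X) * r * (#Y * #X) := by ring

lemma exists_card_mul_card_le_min_mul_card_inter_vadd {G : Type*} [AddCommGroup G]
    [DecidableEq G] {Y X : Finset G} (hY : Y.Nonempty) (hX : X.Nonempty) :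
    ∃ t : G, #Y * #X ≤ min #(Y + X) #(Y - X) * #(Y ∩ (t +ᵥ X)) := by
  obtain ⟨t, -, ht⟩ := exists_max_image (Y - X) (fun t => #(Y ∩ (t +ᵥ X))) (hY.sub hX)
  refine ⟨t, ?_⟩
  rcases min_choice #(Y + X) #(Y - X) with h | h <;> rw [h]
  · exact card_mul_card_le_card_add_mul Y X _ ht
  · exact card_mul_card_le_card_sub_mul Y X _ ht

/-- Greedy covering: if every subset of `Y` with more than `δ` elements has at least `c` elements
in some translate of `X`, then at most `#Y / c` translates cover all but `δ` elements of `Y`. -/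
lemma exists_card_mul_le_and_card_sdiff_le {G : Type*} [AddCommGroup G] [DecidableEq G]
    (X : Finset G) {c δ : ℝ} (hc : 0 < c) (Y : Finset G)
    (h : ∀ Z ⊆ Y, δ < #Z → ∃ t : G, c ≤ #(Z ∩ (t +ᵥ X))) :
    ∃ T : Finset G, #T * c ≤ #Y ∧ (#(Y \ (T + X)) : ℝ) ≤ δ := by
  induction Y using Finset.strongInduction with
  | H Y ih =>
    rcases le_or_gt (#Y : ℝ) δ with hδ | hδ
    · exact ⟨∅, by simp, by simpa using hδ⟩
    obtain ⟨t, ht⟩ := h Y Subset.rfl hδ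
    have hne : (Y ∩ (t +ᵥ X)).Nonempty := card_pos.1 (by exact_mod_cast hc.trans_le ht)
    have hss : Y \ (t +ᵥ X) ⊂ Y := by
      refine sdiff_subset.ssubset_of_ne fun he => ?_
      obtain ⟨y, hy⟩ := hne
      rw [mem_inter] at hy
      exact (mem_sdiff.1 (he.symm ▸ hy.1 : y ∈ Y \ (t +ᵥ X))).2 hy.2
    obtain ⟨T, hT, hcov⟩ := ih _ hss fun Z hZ => h Z (hZ.trans sdiff_subset)
    refine ⟨insert t T, ?_, ?_⟩
    · have hcard : (#(Y \ (t +ᵥ X)) : ℝ) + #(Y ∩ (t +ᵥ X)) = #Y := by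
        exact_mod_cast card_sdiff_add_card_inter Y (t +ᵥ X)
      have hins : (#(insert t T) : ℝ) ≤ #T + 1 := by exact_mod_cast card_insert_le t T
      nlinarith
    · rwa [insert_eq, union_add, singleton_add, ← sup_eq_union, ← sdiff_sdiff_left]

theorem covering_lemma :
    ∀ ε : ℝ, 0 < ε → ε < 1 →
      ∃ C : ℝ, C > 0 ∧
        ∀ (G : Type) [AddCommGroup G] [DecidableEq G] (X₁ X₂ : Finset G),
          X₁.Nonempty → X₂.Nonempty →
          ∃ T : Finset G,
            (T.card : ℝ) ≤ C * min ((X₁ + X₂).card : ℝ) ((X₁ - X₂).card : ℝ) / (X₂.card : ℝ) ∧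
            (1 - ε) * (X₁.card : ℝ) ≤ ((X₁ ∩ (T + X₂)).card : ℝ) := by
  intro ε hε _
  refine ⟨1 / ε, by positivity, ?_⟩
  intro G _ _ X₁ X₂ h₁ h₂
  have p₁ : (0 : ℝ) < #X₁ := by exact_mod_cast h₁.card_pos
  have p₂ : (0 : ℝ) < #X₂ := by exact_mod_cast h₂.card_pos
  set M : ℝ := min (#(X₁ + X₂) : ℝ) #(X₁ - X₂) with hM
  have pM : 0 < M := lt_min (by exact_mod_cast (h₁.add h₂).card_pos)
    (by exact_mod_cast (h₁.sub h₂).card_pos)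
  obtain ⟨T, hT, hcov⟩ := exists_card_mul_le_and_card_sdiff_le X₂
    (c := ε * #X₁ * #X₂ / M) (δ := ε * #X₁) (by positivity) X₁ (by
      intro Z hZ hlt
      have hZne : Z.Nonempty :=
        card_pos.1 (by exact_mod_cast (by positivity : 0 < ε * (#X₁ : ℝ)).trans hlt)
      obtain ⟨t, ht⟩ := exists_card_mul_card_le_min_mul_card_inter_vadd hZne h₂
      refine ⟨t, (div_le_iff₀' pM).2 ?_⟩
      have hmin : ((min #(Z + X₂) #(Z - X₂) : ℕ) : ℝ) ≤ M := by
        rw [hM, Nat.cast_min]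
        exact min_le_min (by exact_mod_cast card_le_card (add_subset_add_right hZ))
          (by exact_mod_cast card_le_card (sub_subset_sub_right hZ))
      calc ε * #X₁ * #X₂ ≤ (#Z : ℝ) * #X₂ := by gcongr
        _ ≤ ((min #(Z + X₂) #(Z - X₂) : ℕ) : ℝ) * #(Z ∩ (t +ᵥ X₂)) := by exact_mod_cast ht
        _ ≤ M * #(Z ∩ (t +ᵥ X₂)) := by gcongr)
  refine ⟨T, ?_, ?_⟩
  · rw [← mul_div_assoc, div_le_iff₀ pM] at hT
    rw [one_div_mul_eq_div, div_div, le_div_iff₀ (by positivity)]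
    refine le_of_mul_le_mul_right ?_ p₁
    linarith
  · have hcard : (#(X₁ \ (T + X₂)) : ℝ) + #(X₁ ∩ (T + X₂)) = #X₁ := by
      exact_mod_cast card_sdiff_add_card_inter X₁ (T + X₂)
    linarith
end

section
/- Let p be a prime and C ⊆ F_p a finite set with |C| ≥ 2, and let R = R(C,C) = {(u−v)/(s−t) : u,v,s,t ∈ C, u ≠ v, s ≠ t}. For r ∈ F_p let E_r(C) be the number of ordered quadruples (a₁,a₂,a₃,a₄) ∈ C⁴ with a₁ + r·a₂ = a₃ + r·a₄. Then Σ_{r ∈ R} E_r(C) ≤ |R|·|C|² + |C|⁴. -/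
open Finset

/-- Each solution of `a₁ + r * a₂ = a₃ + r * a₄` either has `a₁ = a₃` and `a₂ = a₄`, or determines
`r`. -/
theorem sum_card_add_mul_eq_add_mul_le {F : Type*} [Field F] [DecidableEq F] (R C : Finset F) :
    ∑ r ∈ R, ((C ×ˢ C ×ˢ C ×ˢ C).filter
        (fun q => q.1 + r * q.2.1 = q.2.2.1 + r * q.2.2.2)).card ≤
      R.card * C.card ^ 2 + C.card ^ 4 := by
  let E (r : F) := (C ×ˢ C ×ˢ C ×ˢ C).filter (fun q => q.1 + r * q.2.1 = q.2.2.1 + r * q.2.2.2)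
  have diagonal (r : F) : ((E r).filter (fun q => q.2.1 = q.2.2.2)).card ≤ C.card ^ 2 := by
    rw [sq, ← card_product]
    apply card_le_card_of_injOn (fun q => (q.1, q.2.1))
    · rintro ⟨a, b, c, d⟩ h
      simp_all [E]
    · rintro ⟨a, b, c, d⟩ h ⟨a', b', c', d'⟩ h' e
      simp [E] at h h' e
      grind
  have off_diagonal : ∑ r ∈ R, ((E r).filter (fun q => ¬ q.2.1 = q.2.2.2)).card ≤ C.card ^ 4 := by
    rw [← card_biUnion]
    · calc
        _ ≤ (C ×ˢ C ×ˢ C ×ˢ C).card :=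
          card_le_card (biUnion_subset.2 fun r _ =>
            (filter_subset _ _).trans (filter_subset _ _))
        _ = C.card ^ 4 := by simp only [card_product]; ring
    · intro r _ s _ hrs
      rw [Function.onFun_apply, disjoint_left]
      rintro ⟨a, b, c, d⟩ h h'
      simp only [E, mem_filter] at h h'
      have hmul : (r - s) * (b - d) = 0 := by linear_combination h.1.2 - h'.1.2
      exact (mul_ne_zero (sub_ne_zero.2 hrs) (sub_ne_zero.2 h.2)) hmul
  calc
    ∑ r ∈ R, (E r).card
      = ∑ r ∈ R, ((E r).filter (fun q => q.2.1 = q.2.2.2)).card +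
          ∑ r ∈ R, ((E r).filter (fun q => ¬ q.2.1 = q.2.2.2)).card := by
        rw [← sum_add_distrib]
        exact sum_congr rfl fun r _ => (card_filter_add_card_filter_not _).symm
    _ ≤ R.card * C.card ^ 2 + C.card ^ 4 :=
        add_le_add (sum_le_card_nsmul _ _ _ fun r _ => diagonal r) off_diagonal

theorem sum_additive_energy_over_ratio_set {p : ℕ} [Fact p.Prime]
    (C : Finset (ZMod p)) (hC : 2 ≤ C.card) :
    ∑ r ∈ (((C ×ˢ C ×ˢ C ×ˢ C).filter
          (fun q => q.1 ≠ q.2.1 ∧ q.2.2.1 ≠ q.2.2.2)).image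
          (fun q => (q.1 - q.2.1) / (q.2.2.1 - q.2.2.2))),
        ((C ×ˢ C ×ˢ C ×ˢ C).filter
          (fun q => q.1 + r * q.2.1 = q.2.2.1 + r * q.2.2.2)).card ≤
      (((C ×ˢ C ×ˢ C ×ˢ C).filter
          (fun q => q.1 ≠ q.2.1 ∧ q.2.2.1 ≠ q.2.2.2)).image
          (fun q => (q.1 - q.2.1) / (q.2.2.1 - q.2.2.2))).card * C.card ^ 2
        + C.card ^ 4 := by
  exact sum_card_add_mul_eq_add_mul_le _ C
end

section
/- Let p be a prime and C ⊆ F_p a finite set with |C| ≥ 2 such that |R(C,C)| ≥ |C|², where R(C,C) = {(u−v)/(s−t) : u,v,s,t ∈ C, u ≠ v, s ≠ t}. Then there exists r ∈ R(C,C) such that E_r(C) ≤ 2·|C|², where E_r(C) is the number of ordered quadruples (a₁,a₂,a₃,a₄) ∈ C⁴ with a₁ + r·a₂ = a₃ + r·a₄. -/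
open Finset

/-- The solutions of `a₁ + r * a₂ = a₃ + r * a₄` in `C` with `a₁ ≠ a₃`. -/
def nontrivialSolutions {F : Type*} [Field F] [DecidableEq F] (C : Finset F) (r : F) :
    Finset (F × F × F × F) :=
  (C ×ˢ C ×ˢ C ×ˢ C).filter
    (fun q => q.1 + r * q.2.1 = q.2.2.1 + r * q.2.2.2 ∧ q.1 ≠ q.2.2.1)

theorem card_solutions_le {F : Type*} [Field F] [DecidableEq F] (C : Finset F) {r : F}
    (hr : r ≠ 0) :
    ((C ×ˢ C ×ˢ C ×ˢ C).filter
        (fun q => q.1 + r * q.2.1 = q.2.2.1 + r * q.2.2.2)).card ≤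
      C.card ^ 2 + (nontrivialSolutions C r).card := by
  have hsub : (C ×ˢ C ×ˢ C ×ˢ C).filter
        (fun q => q.1 + r * q.2.1 = q.2.2.1 + r * q.2.2.2) ⊆
      (C ×ˢ C).image (fun x => (x.1, x.2, x.1, x.2)) ∪ nontrivialSolutions C r := by
    rintro ⟨a, b, c, d⟩ hq
    simp only [mem_filter, mem_product] at hq
    obtain ⟨⟨ha, hb, hc, hd⟩, h⟩ := hq
    by_cases hac : a = c
    · subst hac
      have hbd : b = d := mul_left_cancel₀ hr (add_left_cancel h)
      subst hbd
      exact mem_union_left _ (mem_image.2 ⟨(a, b), mem_product.2 ⟨ha, hb⟩, rfl⟩)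
    · refine mem_union_right _ ?_
      simp only [nontrivialSolutions, mem_filter, mem_product]
      exact ⟨⟨ha, hb, hc, hd⟩, h, hac⟩
  calc _ ≤ _ := card_le_card hsub
    _ ≤ _ := card_union_le _ _
    _ ≤ (C ×ˢ C).card + _ := Nat.add_le_add_right card_image_le _
    _ = _ := by rw [card_product, sq]

theorem disjoint_nontrivialSolutions {F : Type*} [Field F] [DecidableEq F] (C : Finset F)
    {r s : F} (hrs : r ≠ s) :
    Disjoint (nontrivialSolutions C r) (nontrivialSolutions C s) := by
  rw [Finset.disjoint_left]
  rintro ⟨a, b, c, d⟩ hr hs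
  simp only [nontrivialSolutions, mem_filter] at hr hs
  obtain ⟨-, hr, hac⟩ := hr
  obtain ⟨-, hs, -⟩ := hs
  have h : (r - s) * (b - d) = 0 := by linear_combination hr - hs
  have hbd : b = d :=
    sub_eq_zero.1 ((mul_eq_zero.1 h).resolve_left (sub_ne_zero.2 hrs))
  subst hbd
  exact hac (add_right_cancel hr)

theorem sum_card_nontrivialSolutions_le {F : Type*} [Field F] [DecidableEq F]
    (C R : Finset F) : ∑ r ∈ R, (nontrivialSolutions C r).card ≤ C.card ^ 4 := by
  rw [← card_biUnion fun r _ s _ hrs => disjoint_nontrivialSolutions C hrs]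
  calc _ ≤ (C ×ˢ C ×ˢ C ×ˢ C).card :=
        card_le_card (biUnion_subset.2 fun _ _ => filter_subset _ _)
    _ = _ := by simp only [card_product]; ring

theorem exists_r_small_additive_energy {p : ℕ} [Fact p.Prime]
    (C : Finset (ZMod p)) (hC : 2 ≤ C.card)
    (hR : C.card ^ 2 ≤ (((C ×ˢ C ×ˢ C ×ˢ C).filter
        (fun q => q.1 ≠ q.2.1 ∧ q.2.2.1 ≠ q.2.2.2)).image
        (fun q => (q.1 - q.2.1) / (q.2.2.1 - q.2.2.2))).card) :
    ∃ r ∈ ((C ×ˢ C ×ˢ C ×ˢ C).filter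
        (fun q => q.1 ≠ q.2.1 ∧ q.2.2.1 ≠ q.2.2.2)).image
        (fun q => (q.1 - q.2.1) / (q.2.2.1 - q.2.2.2)),
      ((C ×ˢ C ×ˢ C ×ˢ C).filter
        (fun q => q.1 + r * q.2.1 = q.2.2.1 + r * q.2.2.2)).card ≤ 2 * C.card ^ 2 := by
  have hne : ∀ r ∈ ((C ×ˢ C ×ˢ C ×ˢ C).filter
        (fun q => q.1 ≠ q.2.1 ∧ q.2.2.1 ≠ q.2.2.2)).image
        (fun q => (q.1 - q.2.1) / (q.2.2.1 - q.2.2.2)), r ≠ 0 := by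
    intro r hr
    obtain ⟨q, hq, rfl⟩ := mem_image.1 hr
    obtain ⟨-, h₁, h₂⟩ := mem_filter.1 hq
    exact div_ne_zero (sub_ne_zero.2 h₁) (sub_ne_zero.2 h₂)
  generalize ((C ×ˢ C ×ˢ C ×ˢ C).filter
        (fun q => q.1 ≠ q.2.1 ∧ q.2.2.1 ≠ q.2.2.2)).image
        (fun q => (q.1 - q.2.1) / (q.2.2.1 - q.2.2.2)) = R at hR hne ⊢
  by_contra! h
  have hlarge : ∀ r ∈ R, C.card ^ 2 + 1 ≤ (nontrivialSolutions C r).card := by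
    intro r hr
    have h₁ := h r hr
    have h₂ := card_solutions_le C (hne r hr)
    omega
  have hlower := card_nsmul_le_sum R _ _ hlarge
  have hupper := sum_card_nontrivialSolutions_le C R
  rw [smul_eq_mul] at hlower
  have hpos : 0 < C.card ^ 2 := by positivity
  nlinarith [Nat.mul_le_mul_right (C.card ^ 2 + 1) hR]
end

section
/- There exists an absolute constant c > 0 with the following property. Let p be a prime, A ⊆ F_p \ {0} a finite nonempty set, N ≥ 1 an integer, and Ξ ⊆ F_p \ {0} a finite nonempty set of slopes such that for every ξ ∈ Ξ the fiber A_ξ = {x ∈ A : ξ·x ∈ A} satisfies N ≤ |A_ξ| < 2N. Let L = |Ξ|, M = L·N², and let P = {(x,y) ∈ A×A : y/x ∈ Ξ}. For x ∈ F_p write A_x = {y : (x,y) ∈ P} and for y ∈ F_p write A^y = {x : (x,y) ∈ P}. Then there exist x̃, ỹ ∈ A with |A_{x̃}| ≥ c·L·N/|A| and |A^{ỹ}| ≥ c·L·N/|A|, and a subset à ⊆ A_{x̃} with |Ã| ≥ c·L·M/|A|³, such that for every y ∈ Ã one has |A_{y/x̃} ∩ A^{ỹ}| ≥ c·L·M·N/|A|⁴.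 -/
open Finset

/-- Discarding the elements whose fiber under `f` has fewer than `t` elements costs at most
`t` elements for each value of `f`. -/
lemma card_filter_small_fiber_le {α β : Type*} [DecidableEq β] (s : Finset α) (B : Finset β)
    (f : α → β) (hf : ∀ q ∈ s, f q ∈ B) {t : ℝ} (ht : 0 ≤ t) :
    ((s.filter (fun q => ((s.filter (fun r => f r = f q)).card : ℝ) < t)).card : ℝ)
      ≤ B.card * t := by
  rw [card_eq_sum_card_fiberwise (f := f) (t := B)
    (fun q hq => hf q (mem_filter.1 hq).1)]
  push_cast
  rw [← nsmul_eq_mul]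
  refine sum_le_card_nsmul _ _ _ fun b _ => ?_
  rcases eq_empty_or_nonempty ((s.filter
    (fun q => ((s.filter (fun r => f r = f q)).card : ℝ) < t)).filter (fun q => f q = b))
    with h | ⟨q, hq⟩
  · rw [h]
    simpa using ht
  · simp only [mem_filter] at hq
    obtain ⟨⟨-, hlt⟩, rfl⟩ := hq
    refine le_trans ?_ hlt.le
    gcongr
    exact filter_subset _ _

/-- The elements whose fiber under `f` has at least `t` elements are all but `|B| t` of them. -/
lemma card_le_card_filter_large_fiber_add {α β : Type*} [DecidableEq β] (s : Finset α)
    (B : Finset β) (f : α → β) (hf : ∀ q ∈ s, f q ∈ B) {t : ℝ} (ht : 0 ≤ t) :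
    (s.card : ℝ) ≤
      (s.filter (fun q => t ≤ ((s.filter (fun r => f r = f q)).card : ℝ))).card + B.card * t := by
  have h := card_filter_small_fiber_le s B f hf ht
  have h' := card_filter_add_card_filter_not (s := s)
    (fun q => t ≤ ((s.filter (fun r => f r = f q)).card : ℝ))
  simp only [not_le] at h'
  rw [← h']
  push_cast
  linarith

/-- Some value of `f` is attained at least the average number of times. -/
lemma exists_card_le_card_mul_card_fiber {α β : Type*} [DecidableEq β] (s : Finset α)
    (B : Finset β) (hB : B.Nonempty) (f : α → β) (hf : ∀ q ∈ s, f q ∈ B) :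
    ∃ b ∈ B, (s.card : ℝ) ≤ B.card * (s.filter (fun q => f q = b)).card := by
  obtain ⟨b, hb, hmax⟩ := exists_max_image B (fun b => (s.filter (fun q => f q = b)).card) hB
  refine ⟨b, hb, ?_⟩
  rw [card_eq_sum_card_fiberwise (f := f) (t := B) hf]
  exact_mod_cast sum_le_card_nsmul _ _ _ hmax

/-- In a subset `Q` of a grid, some row `y` has its abscissae shared by many points of `Q`. -/
lemma exists_sq_card_le_card_shared_abscissa {α : Type*} [DecidableEq α] (Q : Finset (α × α))
    (A : Finset α) (hA : A.Nonempty) (hQ : Q ⊆ A ×ˢ A) :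
    ∃ y ∈ A, (Q.card : ℝ) ^ 2 ≤
      (A.card : ℝ) ^ 2 * (Q.filter (fun q => (q.1, y) ∈ Q)).card := by
  obtain ⟨y, hy, hmax⟩ :=
    exists_max_image A (fun y => (Q.filter (fun q => (q.1, y) ∈ Q)).card) hA
  refine ⟨y, hy, ?_⟩
  have h₁ : Q.card = ∑ x ∈ A, (Q.filter (fun q => q.1 = x)).card :=
    card_eq_sum_card_fiberwise fun q hq => (mem_product.1 (hQ hq)).1
  have h₂ : (∑ x ∈ A, (Q.filter (fun q => q.1 = x)).card) ^ 2 ≤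
      A.card * ∑ x ∈ A, (Q.filter (fun q => q.1 = x)).card ^ 2 := sq_sum_le_card_mul_sum_sq
  have h₃ : ∀ x, (A.filter (fun z => (x, z) ∈ Q)).card = (Q.filter (fun q => q.1 = x)).card := by
    intro x
    refine card_bij' (fun z _ => (x, z)) (fun q _ => q.2) ?_ ?_ ?_ ?_
    · intro z hz
      simpa using (mem_filter.1 hz).2
    · rintro ⟨u, v⟩ hq
      obtain ⟨hqQ, rfl⟩ := mem_filter.1 hq
      exact mem_filter.2 ⟨(mem_product.1 (hQ hqQ)).2, hqQ⟩
    · intro z _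
      rfl
    · rintro ⟨u, v⟩ hq
      obtain ⟨-, rfl⟩ := mem_filter.1 hq
      rfl
  have h₄ : ∑ z ∈ A, (Q.filter (fun q => (q.1, z) ∈ Q)).card =
      ∑ x ∈ A, (Q.filter (fun q => q.1 = x)).card ^ 2 := by
    have := sum_card_bipartiteAbove_eq_sum_card_bipartiteBelow (s := A) (t := Q)
      (fun z q => (q.1, z) ∈ Q)
    simp only [bipartiteAbove, bipartiteBelow] at this
    rw [this]
    simp only [h₃]
    rw [← sum_fiberwise_of_maps_to (g := Prod.fst) (t := A)
      fun q hq => (mem_product.1 (hQ hq)).1]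
    refine sum_congr rfl fun x _ => ?_
    rw [sum_congr rfl (g := fun _ => (Q.filter (fun q => q.1 = x)).card), sum_const,
      smul_eq_mul, sq]
    intro q hq
    rw [(mem_filter.1 hq).2]
  have h₅ : ∑ z ∈ A, (Q.filter (fun q => (q.1, z) ∈ Q)).card ≤
      A.card * (Q.filter (fun q => (q.1, y) ∈ Q)).card := by
    simpa using sum_le_card_nsmul _ _ _ hmax
  have h₆ : Q.card ^ 2 ≤ A.card ^ 2 * (Q.filter (fun q => (q.1, y) ∈ Q)).card := by
    calc Q.card ^ 2 ≤ A.card * ∑ x ∈ A, (Q.filter (fun q => q.1 = x)).card ^ 2 := h₁ ▸ h₂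
      _ ≤ A.card * (A.card * (Q.filter (fun q => (q.1, y) ∈ Q)).card) := by
          rw [← h₄]
          gcongr
      _ = _ := by ring
  exact_mod_cast h₆

/-- A set of slopes whose fibers have at least `N` elements supports at least `|Ξ| N` points. -/
lemma card_mul_le_card_points {F : Type*} [Field F] [DecidableEq F] (A Ξ : Finset F) (N : ℕ)
    (hA : ∀ a ∈ A, a ≠ 0) (hN : ∀ ξ ∈ Ξ, N ≤ (A.filter (fun x => ξ * x ∈ A)).card) :
    Ξ.card * N ≤ ((A ×ˢ A).filter (fun q => q.2 / q.1 ∈ Ξ)).card := by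
  rw [card_eq_sum_card_fiberwise (f := fun q : F × F => q.2 / q.1) (t := Ξ)
    (fun q hq => by exact (mem_filter.1 hq).2), ← smul_eq_mul]
  refine card_nsmul_le_sum _ _ _ fun ξ hξ => (hN ξ hξ).trans ?_
  refine card_le_card_of_injOn (fun x => (x, ξ * x)) ?_ ?_
  · intro x hx
    obtain ⟨hx, hξx⟩ := mem_filter.1 hx
    have := mul_div_cancel_right₀ ξ (hA x hx)
    simp [this, hx, hξx, hξ]
  · intro x _ z _ h
    exact congrArg Prod.fst h

/-- Points with nonzero abscissa on a line through the origin are determined by it. -/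
lemma injOn_fst_of_slope {F : Type*} [Field F] {s : Set (F × F)} {ξ : F}
    (hs : ∀ q ∈ s, q.1 ≠ 0 ∧ q.2 / q.1 = ξ) : Set.InjOn Prod.fst s := by
  rintro ⟨a, b⟩ h ⟨a', b'⟩ h' rfl
  obtain ⟨h0, h⟩ := hs _ h
  obtain ⟨-, h'⟩ := hs _ h'
  have := h.trans h'.symm
  rw [div_left_inj' h0] at this
  exact Prod.ext rfl this

/-- Most points of a subset `P` of a grid share both coordinates with many points of `P`. -/
lemma exists_subset_popular_coordinates {α : Type*} [DecidableEq α] (A : Finset α)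
    (hA : A.Nonempty) (P : Finset (α × α)) (hPA : P ⊆ A ×ˢ A) :
    ∃ Q ⊆ P, (P.card : ℝ) / 2 ≤ Q.card ∧ ∀ q ∈ Q,
      (P.card : ℝ) / (4 * A.card) ≤ (P.filter (fun r => r.1 = q.1)).card ∧
      (P.card : ℝ) / (4 * A.card) ≤ (P.filter (fun r => r.2 = q.2)).card := by
  have ha : (0 : ℝ) < A.card := by exact_mod_cast hA.card_pos
  set t : ℝ := P.card / (4 * A.card) with ht
  have ht0 : 0 ≤ t := by positivity
  have hat : A.card * t = P.card / 4 := by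
    rw [ht]
    field_simp
  have hx := card_le_card_filter_large_fiber_add P A Prod.fst
    (fun q hq => (mem_product.1 (hPA hq)).1) ht0
  have hy := card_le_card_filter_large_fiber_add P A Prod.snd
    (fun q hq => (mem_product.1 (hPA hq)).2) ht0
  set X := P.filter (fun q => t ≤ ((P.filter (fun r => r.1 = q.1)).card : ℝ))
  set Y := P.filter (fun q => t ≤ ((P.filter (fun r => r.2 = q.2)).card : ℝ))
  refine ⟨X ∩ Y, inter_subset_left.trans (filter_subset _ _), ?_, fun q hq => ?_⟩
  · have h₁ : X.card + Y.card ≤ P.card + (X ∩ Y).card := by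
      rw [← card_union_add_card_inter]
      gcongr
      exact union_subset (filter_subset _ _) (filter_subset _ _)
    have h₂ : (X.card : ℝ) + Y.card ≤ P.card + (X ∩ Y).card := by exact_mod_cast h₁
    linarith
  · rw [mem_inter] at hq
    exact ⟨(mem_filter.1 hq.1).2, (mem_filter.1 hq.2).2⟩

/-- Some column of `U` has many points whose fiber under `f` is large. -/
lemma exists_column_large_fibers {α β γ : Type*} [DecidableEq β] [DecidableEq γ] (U : Finset α)
    (A : Finset β) (hA : A.Nonempty) (g : α → β) (hg : ∀ q ∈ U, g q ∈ A)
    (B : Finset γ) (hB : B.Nonempty) (f : α → γ) (hf : ∀ q ∈ U, f q ∈ B) :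
    ∃ x ∈ A, ∃ W ⊆ U, (U.card : ℝ) / 2 ≤ A.card * W.card ∧ ∀ q ∈ W, g q = x ∧
      (U.card : ℝ) / (2 * B.card) ≤ (U.filter (fun r => f r = f q)).card := by
  have hb : (0 : ℝ) < B.card := by exact_mod_cast hB.card_pos
  set u : ℝ := U.card / (2 * B.card) with hu
  have hLu : B.card * u = U.card / 2 := by
    rw [hu]
    field_simp
  have hV := card_le_card_filter_large_fiber_add U B f hf (t := u) (by positivity)
  set V := U.filter (fun q => u ≤ ((U.filter (fun r => f r = f q)).card : ℝ))
  obtain ⟨x, hx, hxV⟩ := exists_card_le_card_mul_card_fiber V A hA g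
    (fun q hq => hg q (mem_filter.1 hq).1)
  refine ⟨x, hx, V.filter (fun q => g q = x), (filter_subset _ _).trans (filter_subset _ _),
    by linarith, fun q hq => ?_⟩
  exact ⟨(mem_filter.1 hq).2, (mem_filter.1 (mem_filter.1 hq).1).2⟩

/-- The focusing argument for a nonempty set of points `P` of a grid with slopes in `Ξ`. -/
lemma exists_focus_of_points {F : Type*} [Field F] [DecidableEq F] (A Ξ : Finset F)
    (hA : ∀ a ∈ A, a ≠ 0) (P : Finset (F × F)) (hP : P.Nonempty) (hPA : P ⊆ A ×ˢ A)
    (hPΞ : ∀ q ∈ P, q.2 / q.1 ∈ Ξ) :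
    ∃ x ∈ A, ∃ y ∈ A,
      (P.card : ℝ) / (4 * A.card) ≤ (P.filter (fun q => q.1 = x)).card ∧
      (P.card : ℝ) / (4 * A.card) ≤ (P.filter (fun q => q.2 = y)).card ∧
      ∃ W ⊆ P.filter (fun q => q.1 = x),
        (P.card : ℝ) ^ 2 / 8 ≤ (A.card : ℝ) ^ 3 * W.card ∧
        ∀ q ∈ W, (P.card : ℝ) ^ 2 / 8 ≤ (A.card : ℝ) ^ 2 * Ξ.card *
          (A.filter (fun z => q.2 / q.1 * z ∈ A) ∩
            (P.filter (fun r => r.2 = y)).image Prod.fst).card := by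
  obtain ⟨q₀, hq₀⟩ := hP
  have hAne : A.Nonempty := ⟨_, (mem_product.1 (hPA hq₀)).1⟩
  have hΞne : Ξ.Nonempty := ⟨_, hPΞ _ hq₀⟩
  have hS0 : (0 : ℝ) < P.card := by exact_mod_cast card_pos.2 ⟨q₀, hq₀⟩
  have hL : (0 : ℝ) < Ξ.card := by exact_mod_cast hΞne.card_pos
  obtain ⟨Q, hQP, hQcard, hQpop⟩ := exists_subset_popular_coordinates A hAne P hPA
  obtain ⟨y, hy, hyQ⟩ := exists_sq_card_le_card_shared_abscissa Q A hAne (hQP.trans hPA)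
  set U := Q.filter (fun q => (q.1, y) ∈ Q)
  have hUQ : ∀ q ∈ U, q ∈ Q ∧ (q.1, y) ∈ Q := fun q hq => mem_filter.1 hq
  have hUP : ∀ q ∈ U, q ∈ P := fun q hq => hQP (hUQ q hq).1
  have hUA : ∀ q ∈ U, q.1 ∈ A ∧ q.2 ∈ A := fun q hq => mem_product.1 (hPA (hUP q hq))
  have hUcard : (P.card : ℝ) ^ 2 / 4 ≤ (A.card : ℝ) ^ 2 * U.card := by
    refine le_trans ?_ hyQ
    have := pow_le_pow_left₀ (by positivity) hQcard 2
    linarith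
  clear_value U
  obtain ⟨x, hx, W, hWU, hUW, hW⟩ := exists_column_large_fibers U A hAne Prod.fst
    (fun q hq => (hUA q hq).1) Ξ hΞne (fun q => q.2 / q.1) (fun q hq => hPΞ q (hUP q hq))
  have hWcard : (P.card : ℝ) ^ 2 / 8 ≤ (A.card : ℝ) ^ 3 * W.card := by
    have := mul_le_mul_of_nonneg_left hUW (sq_nonneg (A.card : ℝ))
    linarith
  have hWpos : (0 : ℝ) < W.card :=
    pos_of_mul_pos_right (lt_of_lt_of_le (by positivity) hWcard) (by positivity)
  obtain ⟨w, hw⟩ : W.Nonempty := card_pos.1 (by exact_mod_cast hWpos)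
  obtain ⟨hwQ, hwyQ⟩ := hUQ w (hWU hw)
  refine ⟨x, hx, y, hy, ?_, (hQpop _ hwyQ).2, W, ?_, hWcard, ?_⟩
  · rw [← (hW w hw).1]
    exact (hQpop w hwQ).1
  · exact fun q hq => mem_filter.2 ⟨hUP q (hWU hq), (hW q hq).1⟩
  · intro q hq
    have hsub : (U.filter (fun r => r.2 / r.1 = q.2 / q.1)).image Prod.fst ⊆
        A.filter (fun z => q.2 / q.1 * z ∈ A) ∩
          (P.filter (fun r => r.2 = y)).image Prod.fst := by
      intro z hz
      obtain ⟨r, hr, rfl⟩ := mem_image.1 hz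
      obtain ⟨hrU, hrs⟩ := mem_filter.1 hr
      refine mem_inter.2 ⟨mem_filter.2 ⟨(hUA r hrU).1, ?_⟩, ?_⟩
      · rw [← hrs, div_mul_cancel₀ _ (hA _ (hUA r hrU).1)]
        exact (hUA r hrU).2
      · exact mem_image.2 ⟨(r.1, y), mem_filter.2 ⟨hQP (hUQ r hrU).2, rfl⟩, rfl⟩
    have hcard := card_le_card hsub
    rw [card_image_of_injOn (injOn_fst_of_slope (ξ := q.2 / q.1) fun r hr => by
      obtain ⟨hrU, hrs⟩ := mem_filter.1 hr
      exact ⟨hA _ (hUA r hrU).1, hrs⟩)] at hcard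
    have h := (hW q hq).2.trans (Nat.cast_le.2 hcard)
    rw [div_le_iff₀ (by positivity)] at h
    have := mul_le_mul_of_nonneg_left h (sq_nonneg (A.card : ℝ))
    linarith

theorem focus_lemma :
    ∃ c : ℝ, c > 0 ∧
      ∀ (p : ℕ) [Fact p.Prime] (A Ξ : Finset (ZMod p)) (N : ℕ),
        (∀ a ∈ A, a ≠ 0) → A.Nonempty → 1 ≤ N →
        (∀ ξ ∈ Ξ, ξ ≠ 0) → Ξ.Nonempty →
        (∀ ξ ∈ Ξ, N ≤ (A.filter (fun x => ξ * x ∈ A)).card ∧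
            (A.filter (fun x => ξ * x ∈ A)).card < 2 * N) →
        ∃ xt ∈ A, ∃ yt ∈ A,
          c * Ξ.card * N / A.card ≤
            ((((A ×ˢ A).filter (fun q => q.2 / q.1 ∈ Ξ ∧ q.1 = xt)).image
              Prod.snd).card : ℝ) ∧
          c * Ξ.card * N / A.card ≤
            ((((A ×ˢ A).filter (fun q => q.2 / q.1 ∈ Ξ ∧ q.2 = yt)).image
              Prod.fst).card : ℝ) ∧
          ∃ At ⊆ ((A ×ˢ A).filter (fun q => q.2 / q.1 ∈ Ξ ∧ q.1 = xt)).image Prod.snd,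
            c * Ξ.card * (Ξ.card * N ^ 2) / (A.card : ℝ) ^ 3 ≤ (At.card : ℝ) ∧
            ∀ y ∈ At,
              c * Ξ.card * (Ξ.card * N ^ 2) * N / (A.card : ℝ) ^ 4 ≤
                (((A.filter (fun x => (y / xt) * x ∈ A)) ∩
                  (((A ×ˢ A).filter (fun q => q.2 / q.1 ∈ Ξ ∧ q.2 = yt)).image
                    Prod.fst)).card : ℝ) := by
  refine ⟨1 / 8, by norm_num, ?_⟩
  intro p _ A Ξ N hA hAne hN _ hΞne hfib
  have hS : (Ξ.card : ℝ) * N ≤ ((A ×ˢ A).filter (fun q => q.2 / q.1 ∈ Ξ)).card := by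
    exact_mod_cast card_mul_le_card_points A Ξ N hA fun ξ hξ => (hfib ξ hξ).1
  have hSA : (((A ×ˢ A).filter (fun q => q.2 / q.1 ∈ Ξ)).card : ℝ) ≤ (A.card : ℝ) ^ 2 := by
    rw [sq]
    exact_mod_cast (card_filter_le _ _).trans (card_product A A).le
  have hPA := filter_subset (fun q : ZMod p × ZMod p => q.2 / q.1 ∈ Ξ) (A ×ˢ A)
  have hPΞ : ∀ q ∈ (A ×ˢ A).filter (fun q => q.2 / q.1 ∈ Ξ), q.2 / q.1 ∈ Ξ :=
    fun q hq => (mem_filter.1 hq).2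
  simp only [← filter_filter]
  generalize (A ×ˢ A).filter (fun q => q.2 / q.1 ∈ Ξ) = P at *
  have ha : (0 : ℝ) < A.card := by exact_mod_cast hAne.card_pos
  have hL : (0 : ℝ) < Ξ.card := by exact_mod_cast hΞne.card_pos
  have hN' : (0 : ℝ) < N := by exact_mod_cast hN
  have hS0 : (0 : ℝ) < P.card := lt_of_lt_of_le (by positivity) hS
  have hP : P.Nonempty := card_pos.1 (by exact_mod_cast hS0)
  obtain ⟨x, hx, y, hy, hxP, hyP, W, hWP, hWcard, hW⟩ :=
    exists_focus_of_points A Ξ hA P hP hPA hPΞ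
  have hbound : 1 / 8 * (Ξ.card : ℝ) * N / A.card ≤ P.card / (4 * A.card) := by
    rw [← div_div]
    gcongr
    linarith
  have hinj₁ : Set.InjOn Prod.snd (P.filter (fun q => q.1 = x) : Set (ZMod p × ZMod p)) := by
    intro q hq r hr h
    exact Prod.ext ((mem_filter.1 hq).2.trans (mem_filter.1 hr).2.symm) h
  have hinj₂ : Set.InjOn Prod.fst (P.filter (fun q => q.2 = y) : Set (ZMod p × ZMod p)) := by
    intro q hq r hr h
    exact Prod.ext h ((mem_filter.1 hq).2.trans (mem_filter.1 hr).2.symm)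
  have hsq : ((Ξ.card : ℝ) * N) ^ 2 ≤ (P.card : ℝ) ^ 2 := by gcongr
  refine ⟨x, hx, y, hy, ?_, ?_, W.image Prod.snd, image_subset_image hWP, ?_, ?_⟩
  · rw [card_image_of_injOn hinj₁]
    exact hbound.trans hxP
  · rw [card_image_of_injOn hinj₂]
    exact hbound.trans hyP
  · rw [card_image_of_injOn (hinj₁.mono (coe_subset.2 hWP)), div_le_iff₀ (by positivity)]
    linarith
  · intro z hz
    obtain ⟨q, hq, rfl⟩ := mem_image.1 hz
    have hqx : q.1 = x := (mem_filter.1 (hWP hq)).2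
    have h := hW q hq
    rw [hqx] at h
    rw [div_le_iff₀ (by positivity)]
    refine le_of_mul_le_mul_left ?_ hL
    have h' := mul_le_mul (hS.trans hSA)
      (div_le_div_of_nonneg_right hsq (by norm_num : (0 : ℝ) ≤ 8))
      (by positivity) (sq_nonneg _)
    have := mul_le_mul_of_nonneg_left h (sq_nonneg (A.card : ℝ))
    linarith
end

section
/- There exists an absolute constant C₀ > 0 with the following property: for every abelian group G, every finite nonempty set A ⊆ G, and every K ≥ 1 with |A + A| ≤ K·|A|, there exists a subset A' ⊆ A with |A'| ≥ (9/10)·|A| such that |A' + A' + A' + A'| ≤ C₀·K³·|A|. -/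
open Pointwise Finset

/-- **Plünnecke's inequality** in Petridis' form: a set with small sumset `Y + B` contains a
nonempty subset whose sumsets with the iterates of `B` all grow at the expected rate. -/
theorem exists_subset_card_add_nsmul_le {G : Type*} [AddCommGroup G] [DecidableEq G]
    {Y B : Finset G} {L : ℝ} (hY : Y.Nonempty) (hYB : (#(Y + B) : ℝ) ≤ L * #Y) :
    ∃ X ⊆ Y, X.Nonempty ∧ ∀ n : ℕ, (#(X + n • B) : ℝ) ≤ L ^ n * #X := by
  have hY' : Y ∈ Y.powerset.erase ∅ :=
    mem_erase_of_ne_of_mem hY.ne_empty (mem_powerset_self _)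
  obtain ⟨X, hX, hmin⟩ :=
    exists_min_image (Y.powerset.erase ∅) (fun X ↦ (#(X + B) : ℝ) / #X) ⟨Y, hY'⟩
  rw [mem_erase, mem_powerset, ← nonempty_iff_ne_empty] at hX
  obtain ⟨hX, hXY⟩ := hX
  have hX₀ : (0 : ℝ) < #X := Nat.cast_pos.2 hX.card_pos
  have hXB : (#(X + B) : ℝ) ≤ L * #X :=
    (div_le_iff₀ hX₀).1 ((hmin Y hY').trans ((div_le_iff₀ (Nat.cast_pos.2 hY.card_pos)).2 hYB))
  have hL : 0 ≤ L := nonneg_of_mul_nonneg_left ((Nat.cast_nonneg _).trans hXB) hX₀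
  have hsub : ∀ X' ⊆ X, #(X + B) * #X' ≤ #(X' + B) * #X := by
    intro X' hX'
    obtain rfl | hne := X'.eq_empty_or_nonempty
    · simp
    have := (div_le_div_iff₀ hX₀ (Nat.cast_pos.2 hne.card_pos)).1
      (hmin X' (mem_erase_of_ne_of_mem hne.ne_empty (mem_powerset.2 (hX'.trans hXY))))
    exact_mod_cast this
  refine ⟨X, hXY, hX, fun n ↦ ?_⟩
  induction n with
  | zero => simp
  | succ n ih =>
    refine le_of_mul_le_mul_right ?_ hX₀
    calc
      (#(X + (n + 1) • B) : ℝ) * #X = #(n • B + X + B) * #X := by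
        rw [succ_nsmul, ← add_assoc, add_comm X]
      _ ≤ #(X + B) * #(n • B + X) := mod_cast pluennecke_petridis_inequality_add _ hsub
      _ ≤ (L * #X) * (L ^ n * #X) := by rw [add_comm _ X]; gcongr
      _ = L ^ (n + 1) * #X * #X := by ring

/-- **Plünnecke's inequality** for a large subset: at the cost of a factor `δ⁻¹` in the growth
rate, the subset can be taken to contain all but a proportion `δ` of the original set. -/
theorem exists_large_subset_card_add_nsmul_le {G : Type*} [AddCommGroup G] [DecidableEq G]
    {A B : Finset G} {K δ : ℝ} (hδ : 0 < δ) (hK : 0 ≤ K) (hAB : (#(A + B) : ℝ) ≤ K * #A) :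
    ∃ X ⊆ A, (1 - δ) * #A ≤ #X ∧ ∀ n : ℕ, (#(X + n • B) : ℝ) ≤ (K / δ) ^ n * #X := by
  classical
  obtain ⟨X, hX, hmax⟩ := exists_max_image
    {X ∈ A.powerset | ∀ n : ℕ, (#(X + n • B) : ℝ) ≤ (K / δ) ^ n * #X} card ⟨∅, by simp⟩
  rw [mem_filter, mem_powerset] at hX
  obtain ⟨hXA, hX⟩ := hX
  refine ⟨X, hXA, ?_, hX⟩
  by_contra! hlt
  have hcard : (#(A \ X) : ℝ) = #A - #X := by
    rw [card_sdiff_of_subset hXA, Nat.cast_sub (card_le_card hXA)]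
  have hlarge : δ * #A < #(A \ X) := by linarith
  have hne : (A \ X).Nonempty := by
    rw [← card_pos, ← Nat.cast_pos (α := ℝ)]
    exact hlarge.trans_le' (by positivity)
  have hgrowth : (#(A \ X + B) : ℝ) ≤ K / δ * #(A \ X) := by
    calc
      (#(A \ X + B) : ℝ) ≤ #(A + B) := by gcongr; exact sdiff_subset
      _ ≤ K * #A := hAB
      _ = K / δ * (δ * #A) := by field_simp
      _ ≤ K / δ * #(A \ X) := by gcongr
  obtain ⟨Z, hZ, hZne, hZB⟩ := exists_subset_card_add_nsmul_le hne hgrowth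
  have hdisj : Disjoint X Z := disjoint_sdiff.mono_right hZ
  have hle := hmax (X ∪ Z) <| by
    rw [mem_filter, mem_powerset]
    refine ⟨union_subset hXA (hZ.trans sdiff_subset), fun n ↦ ?_⟩
    calc
      (#(X ∪ Z + n • B) : ℝ) ≤ #(X + n • B) + #(Z + n • B) := by
        rw [union_add]; exact_mod_cast card_union_le _ _
      _ ≤ (K / δ) ^ n * #X + (K / δ) ^ n * #Z := add_le_add (hX n) (hZB n)
      _ = (K / δ) ^ n * #(X ∪ Z) := by rw [card_union_of_disjoint hdisj]; push_cast; ring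
  rw [card_union_of_disjoint hdisj] at hle
  have := hZne.card_pos
  lia

theorem refined_plunnecke_four_fold :
    ∃ C₀ : ℝ, C₀ > 0 ∧
      ∀ (G : Type) [AddCommGroup G] [DecidableEq G] (A : Finset G) (K : ℝ),
        A.Nonempty → 1 ≤ K → ((A + A).card : ℝ) ≤ K * A.card →
        ∃ A' ⊆ A, (9 / 10 : ℝ) * A.card ≤ (A'.card : ℝ) ∧
          ((A' + A' + A' + A').card : ℝ) ≤ C₀ * K ^ 3 * A.card := by
  refine ⟨1000, by norm_num, fun G _ _ A K _ hK hA ↦ ?_⟩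
  obtain ⟨X, hXA, hcard, hX⟩ :=
    exists_large_subset_card_add_nsmul_le (δ := 1 / 10) (by norm_num) (by linarith) hA
  refine ⟨X, hXA, by linarith, ?_⟩
  calc
    (#(X + X + X + X) : ℝ) ≤ #(X + A + A + A) := by gcongr
    _ = #(X + 3 • A) := by rw [succ_nsmul, two_nsmul, ← add_assoc, ← add_assoc]
    _ ≤ (K / (1 / 10)) ^ 3 * #X := hX 3
    _ = 1000 * K ^ 3 * #X := by ring
    _ ≤ 1000 * K ^ 3 * #A := by gcongr
end
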